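/- Let k ≥ 0, let Ω be an open subset of ℝ³, let x ∈ Ω, and let V be a finite open cone with vertex at x. Then the integral over V ∩ Ω of |∇_z Re(e^{ik|z−x|}/|z−x|)|² dz is infinite, i.e. the function z ↦ |∇_z Re(e^{ik|z−x|}/|z−x|)|² is not Lebesgue integrable on V ∩ Ω. -/

import Mathlib

open MeasureTheory Real Set Filter Topology Metric

noncomputable section

abbrev Ed (d : ℕ) := EuclideanSpace ℝ (Fin d)

/-- A finite open cone with vertex `p`: the set `{p + r • ω : 0 < r < R, ω ∈ S}` with `R > 0`
and `S` a nonempty open subset of the unit sphere. -/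
def IsFiniteOpenCone {d : ℕ} (V : Set (Ed d)) (p : Ed d) : Prop :=
  ∃ (R : ℝ) (S : Set (Ed d)), 0 < R ∧ S.Nonempty ∧
    (∃ U : Set (Ed d), IsOpen U ∧ S = U ∩ Metric.sphere (0 : Ed d) 1) ∧
    V = {z | ∃ r : ℝ, 0 < r ∧ r < R ∧ ∃ ω ∈ S, z = p + r • ω}

theorem re_exp_I_mul_div (k r : ℝ) :
    (Complex.exp (Complex.I * k * r) / (r : ℂ)).re = cos (k * r) / r := by
  rw [Complex.div_ofReal_re, show Complex.I * k * r = ((k * r : ℝ) : ℂ) * Complex.I by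
    push_cast; ring, Complex.exp_ofReal_mul_I_re]

theorem hasDerivAt_cos_mul_div (k : ℝ) {r : ℝ} (hr : r ≠ 0) :
    HasDerivAt (fun s : ℝ => cos (k * s) / s)
      (-((k * r * sin (k * r) + cos (k * r)) / r ^ 2)) r := by
  have h1 : HasDerivAt (fun s : ℝ => k * s) k r := by
    simpa using (hasDerivAt_id r).const_mul k
  refine (h1.cos.div (hasDerivAt_id r) hr).congr_deriv ?_
  simp only [id]
  ring

theorem norm_fderiv_comp_norm_sub {E : Type*} [NormedAddCommGroup E] [InnerProductSpace ℝ E]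
    {g : ℝ → ℝ} {g' : ℝ} {x z : E} (hz : z ≠ x) (hg : HasDerivAt g g' ‖z - x‖) :
    ‖fderiv ℝ (fun w : E => g ‖w - x‖) z‖ = |g'| := by
  have hzx : z - x ≠ 0 := sub_ne_zero.mpr hz
  have hn : DifferentiableAt ℝ (fun y : E => ‖y‖) (z - x) :=
    differentiableAt_id.norm ℝ hzx
  have hd : HasFDerivAt (fun w : E => ‖w - x‖) (fderiv ℝ (fun y : E => ‖y‖) (z - x)) z :=
    hn.hasFDerivAt.comp z ((hasFDerivAt_id z).sub_const x)
  have : Nontrivial E := ⟨z, x, hz⟩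
  have hcomp : HasFDerivAt (fun w : E => g ‖w - x‖)
      (g' • fderiv ℝ (fun y : E => ‖y‖) (z - x)) z := hg.comp_hasFDerivAt z hd
  rw [hcomp.fderiv, norm_smul, norm_fderiv_norm hn, mul_one,
    Real.norm_eq_abs]

theorem half_le_mul_sin_add_cos {θ : ℝ} (h0 : 0 ≤ θ) (h1 : θ ≤ 1) :
    1 / 2 ≤ θ * sin θ + cos θ := by
  have hs : 0 ≤ sin θ := sin_nonneg_of_nonneg_of_le_pi h0 (by linarith [pi_gt_three])
  nlinarith [one_sub_sq_div_two_le_cos (x := θ), mul_nonneg h0 hs]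

/-- Near the pole, the squared gradient is at least `1 / (4 ‖z - x‖ ^ 4)`. -/
theorem le_norm_fderiv_sq {E : Type*} [NormedAddCommGroup E] [InnerProductSpace ℝ E]
    {k a : ℝ} (hk : 0 ≤ k) {x z : E} (hz : z ≠ x) (ha : ‖z - x‖ ≤ a) (hka : k * a ≤ 1) :
    1 / (4 * a ^ 4) ≤ ‖fderiv ℝ (fun w : E =>
      (Complex.exp (Complex.I * k * ‖w - x‖) / (‖w - x‖ : ℂ)).re) z‖ ^ 2 := by
  have hr : 0 < ‖z - x‖ := norm_pos_iff.mpr (sub_ne_zero.mpr hz)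
  simp_rw [re_exp_I_mul_div]
  rw [norm_fderiv_comp_norm_sub (g := fun s => cos (k * s) / s) hz
    (hasDerivAt_cos_mul_div k hr.ne'), sq_abs]
  set r := ‖z - x‖
  have hkr : k * r ≤ 1 := (mul_le_mul_of_nonneg_left ha hk).trans hka
  have h := half_le_mul_sin_add_cos (mul_nonneg hk hr.le) hkr
  calc 1 / (4 * a ^ 4) ≤ 1 / (4 * r ^ 4) := by gcongr
    _ = (1 / 2) ^ 2 / (r ^ 2) ^ 2 := by field_simp; norm_num
    _ ≤ (k * r * sin (k * r) + cos (k * r)) ^ 2 / (r ^ 2) ^ 2 := by gcongr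
    _ = _ := by ring

theorem IsFiniteOpenCone.add_smul_mem {d : ℕ} {V : Set (Ed d)} {p v : Ed d}
    (hV : IsFiniteOpenCone V p) (hv : p + v ∈ V) {t : ℝ} (ht : 0 < t) (ht1 : t ≤ 1) :
    p + t • v ∈ V := by
  obtain ⟨R, S, -, -, -, rfl⟩ := hV
  obtain ⟨r, hr, hrR, ω, hω, h⟩ := hv
  obtain rfl := add_left_cancel h
  exact ⟨t * r, by positivity, by nlinarith, ω, hω, by rw [smul_smul]⟩

theorem IsFiniteOpenCone.nonempty {d : ℕ} {V : Set (Ed d)} {p : Ed d}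
    (hV : IsFiniteOpenCone V p) : V.Nonempty := by
  obtain ⟨R, S, hR, ⟨ω, hω⟩, -, rfl⟩ := hV
  exact ⟨_, R / 2, by linarith, by linarith, ω, hω, rfl⟩

theorem IsFiniteOpenCone.ne_vertex {d : ℕ} {V : Set (Ed d)} {p z : Ed d}
    (hV : IsFiniteOpenCone V p) (hz : z ∈ V) : z ≠ p := by
  obtain ⟨R, S, -, -, ⟨U, -, rfl⟩, rfl⟩ := hV
  obtain ⟨r, hr, -, ω, ⟨-, hω⟩, rfl⟩ := hz
  have : ω ≠ 0 := ne_zero_of_mem_unit_sphere (⟨ω, hω⟩ : sphere (0 : Ed d) 1)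
  simp [hr.ne', this]

theorem IsFiniteOpenCone.isOpen {d : ℕ} {V : Set (Ed d)} {p : Ed d}
    (hV : IsFiniteOpenCone V p) : IsOpen V := by
  obtain ⟨R, S, -, -, ⟨U, hU, rfl⟩, rfl⟩ := hV
  rw [isOpen_iff_mem_nhds]
  rintro _ ⟨r, hr, hrR, ω, ⟨hωU, hω⟩, rfl⟩
  rw [mem_sphere_zero_iff_norm] at hω
  have hnorm : ‖p + r • ω - p‖ = r := by simp [norm_smul, hω, abs_of_pos hr]
  have hc : ContinuousAt (fun z : Ed d => ‖z - p‖) (p + r • ω) := by fun_prop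
  have hdir : ContinuousAt (fun z : Ed d => ‖z - p‖⁻¹ • (z - p)) (p + r • ω) :=
    (hc.inv₀ (by rw [hnorm]; exact hr.ne')).smul (by fun_prop)
  have hmem : ‖p + r • ω - p‖⁻¹ • (p + r • ω - p) ∈ U := by
    rwa [hnorm, add_sub_cancel_left, inv_smul_smul₀ hr.ne']
  filter_upwards [hdir (hU.mem_nhds hmem), hc (Ioo_mem_nhds (hnorm ▸ hr) (hnorm ▸ hrR))]
    with z hzU hz
  refine ⟨‖z - p‖, hz.1, hz.2, _, ⟨hzU, ?_⟩, ?_⟩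
  · rw [mem_sphere_zero_iff_norm, norm_smul, norm_inv, norm_norm, inv_mul_cancel₀ hz.1.ne']
  · rw [smul_inv_smul₀ hz.1.ne', add_sub_cancel]

/-- for `k ≥ 0`, `Ω ⊆ ℝ³` open, `x ∈ Ω` and `V` a finite open cone with vertex
at `x`, the function `z ↦ |∇_z Re(e^{ik|z−x|}/|z−x|)|²` is not Lebesgue integrable on `V ∩ Ω`. -/
theorem statement0 (k : ℝ) (hk : 0 ≤ k) (Ω : Set (Ed 3)) (hΩ : IsOpen Ω)
    (x : Ed 3) (hx : x ∈ Ω) (V : Set (Ed 3)) (hV : IsFiniteOpenCone V x) :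
    ¬ IntegrableOn
        (fun z : Ed 3 =>
          ‖fderiv ℝ (fun w : Ed 3 =>
              (Complex.exp (Complex.I * k * ‖w - x‖) / (‖w - x‖ : ℂ)).re) z‖ ^ 2)
        (V ∩ Ω) volume := by
  intro hint
  set f := fun z : Ed 3 => ‖fderiv ℝ (fun w : Ed 3 =>
    (Complex.exp (Complex.I * k * ‖w - x‖) / (‖w - x‖ : ℂ)).re) z‖ ^ 2
  obtain ⟨y, hy⟩ := hV.nonempty
  obtain ⟨ε, hε, hball⟩ := Metric.isOpen_iff.mp hV.isOpen y hy
  obtain ⟨δ, hδ, hδΩ⟩ := Metric.isOpen_iff.mp hΩ x hx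
  set L := ‖y - x‖ + ε
  have hLpos : 0 < L := by positivity
  -- The homothetic images of a ball inside the cone shrink to the vertex.
  have key : ∀ t : ℝ, 0 < t → t ≤ 1 → t * L ≤ δ → k * (t * L) ≤ 1 →
      1 / (4 * (t * L) ^ 4) * ((t * ε) ^ 3 * volume.real (ball (0 : Ed 3) 1)) ≤
        ∫ z in V ∩ Ω, f z := by
    intro t ht ht1 htδ htk
    have hpt : ∀ z ∈ ball (x + t • (y - x)) (t * ε), z ∈ V ∧ ‖z - x‖ < t * L := by
      intro z hz
      obtain ⟨v, rfl⟩ : ∃ v, z = x + t • v :=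
        ⟨t⁻¹ • (z - x), by rw [smul_inv_smul₀ ht.ne', add_sub_cancel]⟩
      rw [mem_ball, dist_add_left, dist_smul₀, Real.norm_of_nonneg ht.le,
        mul_lt_mul_iff_right₀ ht, dist_eq_norm] at hz
      refine ⟨hV.add_smul_mem (hball ?_) ht ht1, ?_⟩
      · rw [mem_ball, dist_eq_norm]
        rwa [show x + v - y = v - (y - x) by abel]
      · rw [add_sub_cancel_left, norm_smul, Real.norm_of_nonneg ht.le,
          mul_lt_mul_iff_right₀ ht]
        linarith [norm_le_norm_add_norm_sub (y - x) v, norm_sub_rev (y - x) v]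
    have hsub : ball (x + t • (y - x)) (t * ε) ⊆ V ∩ Ω := fun z hz =>
      ⟨(hpt z hz).1, hδΩ (by rw [mem_ball, dist_eq_norm]; linarith [(hpt z hz).2])⟩
    have hvol : volume.real (ball (x + t • (y - x)) (t * ε)) =
        (t * ε) ^ 3 * volume.real (ball (0 : Ed 3) 1) := by
      rw [measureReal_def, Measure.addHaar_ball _ _ (by positivity), ENNReal.toReal_mul,
        ENNReal.toReal_ofReal (by positivity), measureReal_def, finrank_euclideanSpace_fin]
    rw [← hvol]
    refine (setIntegral_ge_of_const_le_real measurableSet_ball measure_ball_lt_top.ne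
      (fun z hz => le_norm_fderiv_sq hk (hV.ne_vertex (hpt z hz).1) (hpt z hz).2.le htk)
      (hint.mono_set hsub)).trans ?_
    exact setIntegral_mono_set hint (ae_of_all _ fun z => sq_nonneg _) hsub.eventuallyLE
  set I := ∫ z in V ∩ Ω, f z
  have hI : 0 ≤ I := integral_nonneg fun z => sq_nonneg _
  have hω : 0 < volume.real (ball (0 : Ed 3) 1) :=
    ENNReal.toReal_pos (measure_ball_pos _ _ one_pos).ne' measure_ball_lt_top.ne
  set C := ε ^ 3 * volume.real (ball (0 : Ed 3) 1) / (4 * L ^ 4) with hC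
  have hCpos : 0 < C := by positivity
  have hlim : Tendsto (fun t : ℝ => C * t⁻¹) (𝓝[>] 0) atTop :=
    tendsto_inv_nhdsGT_zero.const_mul_atTop hCpos
  have hsmall : ∀ c a : ℝ, 0 < a → ∀ᶠ t : ℝ in 𝓝[>] 0, t * c < a := fun c a ha =>
    nhdsWithin_le_nhds ((show Continuous fun t : ℝ => t * c by fun_prop).continuousAt.eventually_lt
      continuousAt_const (by simpa using ha))
  obtain ⟨t, hCt, h1, hδt, hkt, ht⟩ := ((hlim.eventually_gt_atTop I).and
    ((hsmall 1 1 one_pos).and ((hsmall L δ hδ).and ((hsmall (k * L) 1 one_pos).and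
      self_mem_nhdsWithin)))).exists
  have ht : 0 < t := ht
  refine (key t ht (by linarith) hδt.le (by linarith)).not_gt (hCt.trans_eq ?_)
  rw [hC]
  field_simp

end
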